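/- arXiv:2605.28613 — 6 statements merged into one kernel-verified Lean document; each statement's English description precedes it below -/
import Mathlib

section
/- Let α > 0, η > 0, ε ∈ (0,1), ε' ∈ (0,1/3). Suppose x_1 < x_2 with x_1 ∈ I_{z−m} and x_2 ∈ I_z for some z ∈ ℕ and m ∈ ℕ₀, and [x_1, x_2] ⊆ D. Let κ > 0 satisfy κ ≤ −max_{x∈[x_1,x_2]}(A'(x) + C'(x)). If x_2 − x_1 ≥ m/κ, then T(x_1) ≥ T(x_2). -/
/-- `K_ε = ln(8/ε) − |ln(1 − √(1/3))|`. -/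
noncomputable def Keps (eps : ℝ) : ℝ :=
  Real.log (8 / eps) - |Real.log (1 - Real.sqrt (1 / 3))|

/-- `A(x) = (1/(2ηx))·(ln(x/α² − 1) − ln 2)`. -/
noncomputable def Afun (alpha eta : ℝ) (x : ℝ) : ℝ :=
  1 / (2 * eta * x) * (Real.log (x / alpha ^ 2 - 1) - Real.log 2)

/-- `B(x) = ⌈(1/α)·√(x/3)⌉`. -/
noncomputable def Bfun (alpha : ℝ) (x : ℝ) : ℝ := (⌈Real.sqrt (x / 3) / alpha⌉ : ℤ)

/-- `C(x) = K_ε/|ln(1 − (2/3)ηx)|`. -/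
noncomputable def Cfun (eta Ke : ℝ) (x : ℝ) : ℝ := Ke / |Real.log (1 - 2 / 3 * eta * x)|

/-- `T(x) = A(x) + B(x) + C(x)`. -/
noncomputable def Tfun (alpha eta eps : ℝ) (x : ℝ) : ℝ :=
  Afun alpha eta x + Bfun alpha x + Cfun eta (Keps eps) x

/-- The level set `I_z = {x ≥ 0 : ⌈(1/α)·√(x/3)⌉ = z}`. -/
def levelSet (alpha : ℝ) (z : ℤ) : Set ℝ :=
  {x : ℝ | 0 ≤ x ∧ ⌈Real.sqrt (x / 3) / alpha⌉ = z}

/-- `A` is differentiable wherever its logarithm has positive argument. -/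
lemma differentiableAt_Afun {alpha eta x : ℝ} (halpha : 0 < alpha) (heta : 0 < eta)
    (hx : alpha ^ 2 < x) : DifferentiableAt ℝ (Afun alpha eta) x := by
  have ha : 0 < alpha ^ 2 := by positivity
  have hx0 : 0 < x := ha.trans hx
  have harg : x / alpha ^ 2 - 1 ≠ 0 := (sub_pos.2 ((one_lt_div ha).2 hx)).ne'
  have hden : 2 * eta * x ≠ 0 := by positivity
  unfold Afun
  fun_prop (disch := assumption)

/-- `C` is differentiable wherever `0 < (2/3)ηx < 1`. -/
lemma differentiableAt_Cfun {eta Ke x : ℝ} (hpos : 0 < eta * x) (hlt : 2 / 3 * eta * x < 1) :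
    DifferentiableAt ℝ (Cfun eta Ke) x := by
  have harg : 1 - 2 / 3 * eta * x ≠ 0 := (sub_pos.2 hlt).ne'
  have hlog : Real.log (1 - 2 / 3 * eta * x) ≠ 0 :=
    (Real.log_neg (sub_pos.2 hlt) (by linarith)).ne
  have hd : DifferentiableAt ℝ (fun y : ℝ => Real.log (1 - 2 / 3 * eta * y)) x := by
    fun_prop (disch := assumption)
  exact (differentiableAt_const Ke).div (hd.abs hlog) (abs_ne_zero.2 hlog)

/-- if `x_1 < x_2` are `m` levels apart, `[x_1,x_2] ⊆ D`, `κ > 0` satisfies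
`κ ≤ −max_{x∈[x_1,x_2]}(A'(x) + C'(x))`, and `x_2 − x_1 ≥ m/κ`, then `T(x_1) ≥ T(x_2)`. -/
theorem stmt1 (alpha eta eps eps' : ℝ) (halpha : 0 < alpha) (heta : 0 < eta)
    (heps : eps ∈ Set.Ioo (0 : ℝ) 1) (heps' : eps' ∈ Set.Ioo (0 : ℝ) (1 / 3))
    (x1 x2 : ℝ) (hx : x1 < x2) (z : ℕ) (m : ℕ)
    (hx1 : x1 ∈ levelSet alpha ((z : ℤ) - (m : ℤ)))
    (hx2 : x2 ∈ levelSet alpha (z : ℤ))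
    (hsub : Set.Icc x1 x2 ⊆ Set.Icc (alpha ^ 2 / eps') (1 / (4 * eta)))
    (κ : ℝ) (hκpos : 0 < κ)
    (hκ : ∀ x ∈ Set.Icc x1 x2,
      deriv (Afun alpha eta) x + deriv (Cfun eta (Keps eps)) x ≤ -κ)
    (hgap : (m : ℝ) / κ ≤ x2 - x1) :
    Tfun alpha eta eps x2 ≤ Tfun alpha eta eps x1 := by
  have hdiff : ∀ x ∈ Set.Icc x1 x2, DifferentiableAt ℝ (Afun alpha eta) x ∧
      DifferentiableAt ℝ (Cfun eta (Keps eps)) x := by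
    intro x hxI
    obtain ⟨hlo, hhi⟩ := hsub hxI
    have ha : 0 < alpha ^ 2 := by positivity
    have hax : alpha ^ 2 < x :=
      ((lt_div_iff₀ heps'.1).2 (by nlinarith [heps'.2])).trans_le hlo
    have hex : 0 < eta * x := mul_pos heta (ha.trans hax)
    have hle : x * (4 * eta) ≤ 1 := (le_div_iff₀ (by positivity)).1 hhi
    exact ⟨differentiableAt_Afun halpha heta hax, differentiableAt_Cfun hex (by linarith)⟩
  have hdecr : (Afun alpha eta + Cfun eta (Keps eps)) x2
      - (Afun alpha eta + Cfun eta (Keps eps)) x1 ≤ -κ * (x2 - x1) := by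
    refine (convex_Icc x1 x2).image_sub_le_mul_sub_of_deriv_le
      (fun x h => ((hdiff x h).1.add (hdiff x h).2).continuousAt.continuousWithinAt)
      (fun x h => ((hdiff x (interior_subset h)).1.add
        (hdiff x (interior_subset h)).2).differentiableWithinAt)
      (fun x h => ?_) x1 (Set.left_mem_Icc.2 hx.le) x2 (Set.right_mem_Icc.2 hx.le) hx.le
    have hxI := interior_subset h
    rw [deriv_add (hdiff x hxI).1 (hdiff x hxI).2]
    exact hκ x hxI
  have hm : (m : ℝ) ≤ (x2 - x1) * κ := (div_le_iff₀ hκpos).1 hgap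
  simp only [Pi.add_apply] at hdecr
  simp only [Tfun, Bfun, hx1.2, hx2.2]
  push_cast
  linarith
end

section
/- Let α > 0, η > 0, ε ∈ (0,1), ε' ∈ (0,1/3). Suppose [x_1, x_2] ⊆ D and x_1 ≥ 2(e+1)α². Then max_{x∈[x_1,x_2]} (A'(x) + C'(x)) ≤ −2ηK_ε / (3·(1 − (2/3)ηx_1)·(ln(1 − (2/3)ηx_2))²). -/
theorem log_one_sub_sqrt_third_abs_lt : |Real.log (1 - Real.sqrt (1 / 3))| < Real.log 8 := by
  have h1 : Real.sqrt (1 / 3) < 3 / 4 := by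
    rw [Real.sqrt_lt' (by norm_num)]
    norm_num
  have h0 : 0 ≤ Real.sqrt (1 / 3) := Real.sqrt_nonneg _
  have h2 : Real.log (1 - Real.sqrt (1 / 3)) ≤ 0 :=
    Real.log_nonpos (by linarith) (by linarith)
  rw [abs_of_nonpos h2, ← Real.log_inv]
  apply Real.log_lt_log (inv_pos.mpr (by linarith))
  rw [inv_lt_comm₀ (by linarith) (by norm_num)]
  linarith

theorem Keps_pos {eps : ℝ} (h : eps ∈ Set.Ioo (0 : ℝ) 1) : 0 < Keps eps := by
  obtain ⟨h0, h1⟩ := h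
  have h2 : Real.log 8 ≤ Real.log (8 / eps) := by
    apply Real.log_le_log (by norm_num)
    rw [le_div_iff₀ h0]
    linarith
  have := log_one_sub_sqrt_third_abs_lt
  unfold Keps
  linarith

theorem one_add_inv_le_log {w : ℝ} (hw : Real.exp 1 + 1 / 2 ≤ w) :
    1 + 1 / (2 * w) ≤ Real.log w := by
  have he := Real.exp_pos 1
  have hw0 : 0 < w := by linarith
  have h1 := Real.one_sub_inv_le_log_of_pos (div_pos hw0 he)
  rw [Real.log_div hw0.ne' he.ne', Real.log_exp, inv_div] at h1
  have h2 : 1 / (2 * w) ≤ 1 - Real.exp 1 / w := by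
    rw [← sub_nonneg]
    have : 1 - Real.exp 1 / w - 1 / (2 * w) = (w - (Real.exp 1 + 1 / 2)) / w := by
      field_simp
      ring
    rw [this]
    exact div_nonneg (by linarith) hw0.le
  linarith

theorem deriv_Afun_nonpos {alpha eta x : ℝ} (halpha : 0 < alpha) (heta : 0 < eta)
    (hx : 2 * (Real.exp 1 + 1) * alpha ^ 2 ≤ x) : deriv (Afun alpha eta) x ≤ 0 := by
  have he := Real.exp_pos 1
  have ha : 0 < alpha ^ 2 := by positivity
  have hx0 : 0 < x := lt_of_lt_of_le (by positivity) hx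
  have hu : 2 * (Real.exp 1 + 1) ≤ x / alpha ^ 2 := by rwa [le_div_iff₀ ha]
  have hv : 0 < x / alpha ^ 2 - 1 := by linarith
  have h1 : HasDerivAt (fun y : ℝ => 1 / (2 * eta * y)) (-(2 * eta) / (2 * eta * x) ^ 2) x := by
    have hm : HasDerivAt (fun y : ℝ => 2 * eta * y) (2 * eta) x := by
      simpa using (hasDerivAt_id x).const_mul (2 * eta)
    simp only [one_div]
    exact hm.fun_inv (by positivity)
  have h2 : HasDerivAt (fun y : ℝ => Real.log (y / alpha ^ 2 - 1) - Real.log 2)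
      (1 / alpha ^ 2 / (x / alpha ^ 2 - 1)) x :=
    ((((hasDerivAt_id x).div_const (alpha ^ 2)).sub_const 1).log hv.ne').sub_const _
  have h3 : HasDerivAt (Afun alpha eta) _ x := h1.mul h2
  rw [h3.deriv]
  have h4 := one_add_inv_le_log (w := (x / alpha ^ 2 - 1) / 2) (by linarith)
  rw [Real.log_div hv.ne' (by norm_num), mul_div_cancel₀ _ (two_ne_zero)] at h4
  set L := Real.log (x / alpha ^ 2 - 1) - Real.log 2
  have h5 : -(2 * eta) / (2 * eta * x) ^ 2 * L
      + 1 / (2 * eta * x) * (1 / alpha ^ 2 / (x / alpha ^ 2 - 1))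
      = (1 + 1 / (x / alpha ^ 2 - 1) - L) / (2 * eta * x ^ 2) := by
    have h6 : x - alpha ^ 2 ≠ 0 := by
      intro h
      have : x / alpha ^ 2 = 1 := by rw [sub_eq_zero.mp h, div_self ha.ne']
      linarith
    field_simp
    ring
  rw [h5]
  exact div_nonpos_of_nonpos_of_nonneg (by linarith) (by positivity)

theorem deriv_Cfun {eta x : ℝ} (K : ℝ) (h0 : 0 < 2 / 3 * eta * x) (h1 : 2 / 3 * eta * x < 1) :
    deriv (Cfun eta K) x =
      -(2 * eta * K) /
        (3 * (1 - 2 / 3 * eta * x) * (Real.log (1 - 2 / 3 * eta * x)) ^ 2) := by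
  have hp : 0 < 1 - 2 / 3 * eta * x := by linarith
  have hl : Real.log (1 - 2 / 3 * eta * x) < 0 := Real.log_neg hp (by linarith)
  have hd : HasDerivAt (fun y : ℝ => 1 - 2 / 3 * eta * y) (-(2 / 3 * eta)) x := by
    simpa using ((hasDerivAt_id x).const_mul (2 / 3 * eta)).const_sub 1
  have hlog := hd.log hp.ne'
  have hC : HasDerivAt (fun y : ℝ => K / -Real.log (1 - 2 / 3 * eta * y)) _ x :=
    (hasDerivAt_const x K).div hlog.neg (neg_ne_zero.mpr hl.ne)
  have heq : Cfun eta K =ᶠ[nhds x] fun y : ℝ => K / -Real.log (1 - 2 / 3 * eta * y) := by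
    filter_upwards [hlog.continuousAt.eventually_lt continuousAt_const hl] with y hy
    rw [Cfun, abs_of_neg hy]
  rw [heq.deriv_eq, hC.deriv]
  generalize Real.log (1 - 2 / 3 * eta * x) = L at hl
  generalize 1 - 2 / 3 * eta * x = p at hp
  have := hl.ne
  field_simp
  ring

/-- if `[x_1, x_2] ⊆ D = [α²/ε', 1/(4η)]` and `x_1 ≥ 2(e+1)α²`, then
`max_{x∈[x_1,x_2]} (A'(x) + C'(x)) ≤ −2ηK_ε / (3(1 − (2/3)ηx_1)(ln(1 − (2/3)ηx_2))²)`. -/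
theorem stmt3 (alpha eta eps eps' : ℝ) (halpha : 0 < alpha) (heta : 0 < eta)
    (heps : eps ∈ Set.Ioo (0 : ℝ) 1) (heps' : eps' ∈ Set.Ioo (0 : ℝ) (1 / 3))
    (x1 x2 : ℝ)
    (hsub : Set.Icc x1 x2 ⊆ Set.Icc (alpha ^ 2 / eps') (1 / (4 * eta)))
    (hx1 : 2 * (Real.exp 1 + 1) * alpha ^ 2 ≤ x1) :
    ∀ x ∈ Set.Icc x1 x2,
      deriv (Afun alpha eta) x + deriv (Cfun eta (Keps eps)) x ≤
        -(2 * eta * Keps eps) /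
          (3 * (1 - 2 / 3 * eta * x1) * (Real.log (1 - 2 / 3 * eta * x2)) ^ 2) := by
  rintro x ⟨hx1x, hxx2⟩
  have he := Real.exp_pos 1
  have hx10 : 0 < x1 := lt_of_lt_of_le (by positivity) hx1
  have hx2 : x2 ≤ 1 / (4 * eta) := (hsub ⟨hx1x.trans hxx2, le_rfl⟩).2
  have hx2' : 2 / 3 * eta * x2 < 1 := by
    rw [le_div_iff₀ (by positivity)] at hx2
    linarith
  have hc : 0 < 2 / 3 * eta := by positivity
  have hle1 : 2 / 3 * eta * x1 ≤ 2 / 3 * eta * x := mul_le_mul_of_nonneg_left hx1x hc.le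
  have hle2 : 2 / 3 * eta * x ≤ 2 / 3 * eta * x2 := mul_le_mul_of_nonneg_left hxx2 hc.le
  have h1 : 0 < 2 / 3 * eta * x1 := mul_pos hc hx10
  have hA := deriv_Afun_nonpos halpha heta (hx1.trans hx1x)
  have hK := Keps_pos heps
  rw [deriv_Cfun (Keps eps) (by linarith) (by linarith)]
  have hlx : Real.log (1 - 2 / 3 * eta * x) < 0 := Real.log_neg (by linarith) (by linarith)
  have hlog : Real.log (1 - 2 / 3 * eta * x2) ≤ Real.log (1 - 2 / 3 * eta * x) :=
    Real.log_le_log (by linarith) (by linarith)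
  have hsq : Real.log (1 - 2 / 3 * eta * x) ^ 2 ≤ Real.log (1 - 2 / 3 * eta * x2) ^ 2 := by
    nlinarith
  have hp : 0 < 1 - 2 / 3 * eta * x := by linarith
  have hmain : 2 * eta * Keps eps /
        (3 * (1 - 2 / 3 * eta * x1) * (Real.log (1 - 2 / 3 * eta * x2)) ^ 2) ≤
      2 * eta * Keps eps /
        (3 * (1 - 2 / 3 * eta * x) * (Real.log (1 - 2 / 3 * eta * x)) ^ 2) := by
    apply div_le_div_of_nonneg_left (by positivity)
    · exact mul_pos (by linarith) (sq_pos_of_neg hlx)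
    · exact mul_le_mul (by linarith) hsq (sq_nonneg _) (by linarith)
  rw [neg_div, neg_div]
  linarith
end

section
/- Let α > 0, ε ∈ (0,1), ε' ∈ (0,1/3), η > 0, and let λ_1 > λ_2 > … > λ_L be reals in the admissible domain D with λ_1 ≥ 1 and λ_L ≥ 2(e+1)α². Set κ(λ_{ℓ+1}, λ_ℓ) = 2ηK_ε / (3·(1 − (2/3)ηλ_{ℓ+1})·(ln(1 − (2/3)ηλ_ℓ))²). If for every ℓ ∈ [L−1] one has λ_ℓ − λ_{ℓ+1} ≥ (1/κ(λ_{ℓ+1}, λ_ℓ))·(⌈(1/α)·√(λ_ℓ/3)⌉ − ⌈(1/α)·√(λ_{ℓ+1}/3)⌉), then T_0({λ_ℓ}_{ℓ=1}^{L}, ε, α, η) = T_2^Id(λ_L, (√λ_L/8)·ε, α, η). -/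
/-- `T_2^Id(λ, ε, α, η)` from the paper. -/
noncomputable def T2Id (lam eps alpha eta : ℝ) : ℝ :=
  1 / (2 * eta * lam) * (Real.log (lam / alpha ^ 2 - 1) - Real.log 2)
    + (⌈Real.sqrt (lam / 3) / alpha⌉ : ℤ)
    + (Real.log (Real.sqrt lam / eps) - |Real.log (1 - Real.sqrt (1 / 3))|)
      / |Real.log (1 - 2 / 3 * eta * lam)|

/-- `T_0({λ_ℓ}_{ℓ=1}^L, ε, α, η)` from the paper (eigenvalues indexed `1,…,L`). -/
noncomputable def Tzero (L : ℕ) (hL : 1 ≤ L) (lam : ℕ → ℝ) (eps alpha eta : ℝ) : ℝ :=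
  max (T2Id (lam 1) (lam 1 / 2) alpha eta)
    ((Finset.Icc 1 L).sup' (Finset.nonempty_Icc.mpr hL)
      (fun ℓ => T2Id (lam ℓ) (Real.sqrt (lam ℓ) / 8 * eps) alpha eta))

/-- `κ(λ_{ℓ+1}, λ_ℓ) = 2ηK_ε / (3(1 − (2/3)ηλ_{ℓ+1})(ln(1 − (2/3)ηλ_ℓ))²)`. -/
noncomputable def kappaFun (eta Ke lamNext lamCur : ℝ) : ℝ :=
  2 * eta * Ke / (3 * (1 - 2 / 3 * eta * lamNext) * (Real.log (1 - 2 / 3 * eta * lamCur)) ^ 2)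

theorem Keps_pos_s4 {eps : ℝ} (h0 : 0 < eps) (h1 : eps < 1) : 0 < Keps eps := by
  have hs : Real.sqrt (1 / 3) < 3 / 4 := by
    rw [Real.sqrt_lt' (by norm_num)]; norm_num
  have hs0 : 0 ≤ Real.sqrt (1 / 3) := Real.sqrt_nonneg _
  have hpos : 0 < 1 - Real.sqrt (1 / 3) := by linarith
  have hle : Real.log (1 - Real.sqrt (1 / 3)) ≤ 0 :=
    Real.log_nonpos hpos.le (by linarith)
  have h8 : 8 < 8 / eps := by rw [lt_div_iff₀ h0]; linarith
  unfold Keps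
  rw [abs_of_nonpos hle, sub_neg_eq_add, ← Real.log_mul (by positivity) hpos.ne']
  exact Real.log_pos (by nlinarith)

theorem div_sub_one_le_log {u : ℝ} (hu : 2 * (Real.exp 1 + 1) ≤ u) :
    u / (u - 1) ≤ Real.log (u - 1) - Real.log 2 := by
  have he := Real.exp_pos 1
  have hu1 : 0 < u - 1 := by linarith
  have h := Real.one_sub_inv_le_log_of_pos (x := (u - 1) / (2 * Real.exp 1)) (by positivity)
  rw [Real.log_div hu1.ne' (by positivity), Real.log_mul (by norm_num) he.ne', Real.log_exp,
    inv_div] at h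
  have h2 : u / (u - 1) ≤ 2 - 2 * Real.exp 1 / (u - 1) := by
    rw [le_sub_iff_add_le, ← add_div, div_le_iff₀ hu1]; linarith
  linarith

theorem log_sub_log_two_div_antitone {u v : ℝ} (hu : 2 * (Real.exp 1 + 1) ≤ u) (huv : u ≤ v) :
    (Real.log (v - 1) - Real.log 2) / v ≤ (Real.log (u - 1) - Real.log 2) / u := by
  have he := Real.exp_pos 1
  have hu1 : 0 < u - 1 := by linarith
  have hv1 : 0 < v - 1 := by linarith
  have hu0 : 0 < u := by linarith
  have hv0 : 0 < v := by linarith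
  have h1 := div_sub_one_le_log hu
  have h2 := Real.log_le_sub_one_of_pos (x := (v - 1) / (u - 1)) (by positivity)
  rw [Real.log_div hv1.ne' hu1.ne'] at h2
  have h3 : (v - 1) / (u - 1) - 1 = (v - u) / (u - 1) := by field_simp; ring
  have h4 : u * ((v - u) / (u - 1)) = (v - u) * (u / (u - 1)) := by ring
  rw [div_le_div_iff₀ hv0 hu0]
  have h5 := mul_le_mul_of_nonneg_left h1 (sub_nonneg.mpr huv)
  have h6 := mul_le_mul_of_nonneg_left (h2.trans_eq h3) hu0.le
  nlinarith

theorem div_le_inv_neg_log_sub {p q : ℝ} (hp : 0 < p) (hpq : p ≤ q) (hq : q < 1) :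
    (q - p) / (q * Real.log p ^ 2) ≤ 1 / |Real.log q| - 1 / |Real.log p| := by
  have hq0 : 0 < q := hp.trans_le hpq
  have hlq : Real.log q < 0 := Real.log_neg hq0 hq
  have hlpq : Real.log p ≤ Real.log q := Real.log_le_log hp hpq
  have hlp : Real.log p < 0 := hlpq.trans_lt hlq
  have h := Real.one_sub_inv_le_log_of_pos (x := q / p) (by positivity)
  rw [Real.log_div hq0.ne' hp.ne', inv_div] at h
  rw [abs_of_neg hlq, abs_of_neg hlp]
  calc (q - p) / (q * Real.log p ^ 2) = (1 - p / q) / Real.log p ^ 2 := by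
        field_simp
    _ ≤ (Real.log q - Real.log p) / Real.log p ^ 2 := by gcongr
    _ ≤ (Real.log q - Real.log p) / (Real.log p * Real.log q) := by
        apply div_le_div_of_nonneg_left (by linarith) (mul_pos_of_neg_of_neg hlp hlq)
        nlinarith
    _ = _ := by field_simp [hlp.ne, hlq.ne]; ring

theorem T2Id_sqrt_mul {lam eps alpha eta : ℝ} (hlam : 0 < lam) (halpha : 0 < alpha) :
    T2Id lam (Real.sqrt lam / 8 * eps) alpha eta
      = 1 / (2 * eta) / alpha ^ 2 *
          ((Real.log (lam / alpha ^ 2 - 1) - Real.log 2) / (lam / alpha ^ 2))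
        + (⌈Real.sqrt (lam / 3) / alpha⌉ : ℤ)
        + Keps eps * (1 / |Real.log (1 - 2 / 3 * eta * lam)|) := by
  have hs : 0 < Real.sqrt lam := Real.sqrt_pos.mpr hlam
  have h : Real.sqrt lam / (Real.sqrt lam / 8 * eps) = 8 / eps := by
    rw [div_mul_eq_mul_div, div_div_eq_mul_div, mul_div_mul_left _ _ hs.ne']
  unfold T2Id Keps
  rw [h, mul_one_div, div_div_eq_mul_div, div_mul_div_comm]
  congr 2
  field_simp

theorem T2Id_le_of_gap {alpha eta eps x y : ℝ} (halpha : 0 < alpha) (heta : 0 < eta)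
    (heps : eps ∈ Set.Ioo (0 : ℝ) 1) (hy : 2 * (Real.exp 1 + 1) * alpha ^ 2 ≤ y) (hyx : y < x)
    (hx : x ≤ 1 / (4 * eta))
    (hgap : 1 / kappaFun eta (Keps eps) y x *
        ((⌈Real.sqrt (x / 3) / alpha⌉ : ℤ) - (⌈Real.sqrt (y / 3) / alpha⌉ : ℤ)) ≤ x - y) :
    T2Id x (Real.sqrt x / 8 * eps) alpha eta ≤ T2Id y (Real.sqrt y / 8 * eps) alpha eta := by
  have hK := Keps_pos_s4 heps.1 heps.2
  have hy0 : 0 < y := lt_of_lt_of_le (by positivity) hy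
  have hx0 : 0 < x := hy0.trans hyx
  rw [le_div_iff₀ (by positivity)] at hx
  have hp : 0 < 1 - 2 / 3 * eta * x := by nlinarith
  have hpq : 1 - 2 / 3 * eta * x ≤ 1 - 2 / 3 * eta * y := by nlinarith
  have hq : 1 - 2 / 3 * eta * y < 1 := by nlinarith [mul_pos heta hy0]
  have hq0 := hp.trans_le hpq
  have hlp : Real.log (1 - 2 / 3 * eta * x) < 0 :=
    Real.log_neg hp (hpq.trans_lt hq)
  have hlp2 := pow_pos (neg_pos.mpr hlp) 2
  rw [neg_sq] at hlp2
  have hκ : 0 < kappaFun eta (Keps eps) y x := by unfold kappaFun; positivity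
  rw [one_div_mul_eq_div, div_le_iff₀ hκ] at hgap
  have hκ' : (x - y) * kappaFun eta (Keps eps) y x
      = Keps eps * ((1 - 2 / 3 * eta * y - (1 - 2 / 3 * eta * x)) /
        ((1 - 2 / 3 * eta * y) * Real.log (1 - 2 / 3 * eta * x) ^ 2)) := by
    unfold kappaFun
    generalize Real.log (1 - 2 / 3 * eta * x) ^ 2 = l at *
    have e : 1 - 2 / 3 * eta * y - (1 - 2 / 3 * eta * x) = 2 / 3 * eta * (x - y) := by ring
    rw [e]
    generalize 1 - 2 / 3 * eta * y = q at *
    field_simp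
  have h1 := mul_le_mul_of_nonneg_left (div_le_inv_neg_log_sub hp hpq hq) hK.le
  have h2 := log_sub_log_two_div_antitone (u := y / alpha ^ 2) (v := x / alpha ^ 2)
    (by rwa [le_div_iff₀ (by positivity)]) (by gcongr)
  have h3 := mul_le_mul_of_nonneg_left h2 (a := 1 / (2 * eta) / alpha ^ 2) (by positivity)
  rw [T2Id_sqrt_mul hx0 halpha, T2Id_sqrt_mul hy0 halpha]
  linarith

theorem T2Id_half_le {lam eps alpha eta : ℝ} (hlam : 1 ≤ lam) (h0 : 0 < eps) (h1 : eps < 1) :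
    T2Id lam (lam / 2) alpha eta ≤ T2Id lam (Real.sqrt lam / 8 * eps) alpha eta := by
  have hs : 1 ≤ Real.sqrt lam := Real.one_le_sqrt.mpr hlam
  have hsq : Real.sqrt lam ^ 2 = lam := Real.sq_sqrt (by linarith)
  unfold T2Id
  gcongr
  nlinarith


/-- under the explicit spectral-gap condition, the start time `T_0` equals
`T₂^Id(λ_L, (√λ_L/8)ε, α, η)`. -/
theorem stmt4 (alpha eta eps eps' : ℝ) (halpha : 0 < alpha) (heta : 0 < eta)
    (heps : eps ∈ Set.Ioo (0 : ℝ) 1) (heps' : eps' ∈ Set.Ioo (0 : ℝ) (1 / 3))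
    (L : ℕ) (hL : 1 ≤ L) (lam : ℕ → ℝ)
    (hmono : ∀ ℓ, 1 ≤ ℓ → ℓ < L → lam (ℓ + 1) < lam ℓ)
    (hD : ∀ ℓ, 1 ≤ ℓ → ℓ ≤ L → lam ℓ ∈ Set.Icc (alpha ^ 2 / eps') (1 / (4 * eta)))
    (hlam1 : 1 ≤ lam 1)
    (hlamL : 2 * (Real.exp 1 + 1) * alpha ^ 2 ≤ lam L)
    (hgap : ∀ ℓ, 1 ≤ ℓ → ℓ < L →
      1 / kappaFun eta (Keps eps) (lam (ℓ + 1)) (lam ℓ) *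
          ((⌈Real.sqrt (lam ℓ / 3) / alpha⌉ : ℤ) - (⌈Real.sqrt (lam (ℓ + 1) / 3) / alpha⌉ : ℤ))
        ≤ lam ℓ - lam (ℓ + 1)) :
    Tzero L hL lam eps alpha eta = T2Id (lam L) (Real.sqrt (lam L) / 8 * eps) alpha eta := by
  have hstep : ∀ ℓ, 1 ≤ ℓ → ℓ ≤ L → lam L ≤ lam ℓ ∧
      T2Id (lam ℓ) (Real.sqrt (lam ℓ) / 8 * eps) alpha eta
        ≤ T2Id (lam L) (Real.sqrt (lam L) / 8 * eps) alpha eta := by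
    intro ℓ h1 hℓ
    induction hℓ using Nat.decreasingInduction with
    | self => exact ⟨le_rfl, le_rfl⟩
    | of_succ k hk ih =>
      obtain ⟨ihle, ihT⟩ := ih (by omega)
      have hlt := hmono k h1 hk
      exact ⟨ihle.trans hlt.le, (T2Id_le_of_gap halpha heta heps (hlamL.trans ihle) hlt
        (hD k h1 hk.le).2 (hgap k h1 hk)).trans ihT⟩
  unfold Tzero
  apply le_antisymm
  · refine max_le ?_ (Finset.sup'_le _ _ fun ℓ hℓ => ?_)
    · exact (T2Id_half_le hlam1 heps.1 heps.2).trans (hstep 1 le_rfl hL).2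
    · rw [Finset.mem_Icc] at hℓ
      exact (hstep ℓ hℓ.1 hℓ.2).2
  · exact le_max_of_le_right (Finset.le_sup'
      (fun ℓ => T2Id (lam ℓ) (Real.sqrt (lam ℓ) / 8 * eps) alpha eta)
      (Finset.mem_Icc.mpr ⟨hL, le_rfl⟩))
end

section
/- Let W̃ ∈ ℝ^{n×n} be symmetric with eigendecomposition W̃ = Ṽ·Σ̃·Ṽᵀ, where Ṽ is orthogonal and Σ̃ is diagonal. Let W_1(k), …, W_N(k) follow the depth-N gradient descent dynamics with target W̃ and initialization W_j(0) = αI for all j. Then for every k ∈ ℕ₀ the matrices D_j(k) := Ṽᵀ·W_j(k)·Ṽ are real, diagonal, and identical across j ∈ [N], i.e. D_j(k) = D(k) for some diagonal D(k), and D(k) satisfies D(0) = αI and D(k+1) = D(k) − η·D(k)^{N−1}·(D(k)^N − Σ̃). -/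
open Matrix

/-- Product `M a * M (a-1) * ⋯ * M b` (identity when `b > a`). -/
noncomputable def prodDesc {n : ℕ} (M : ℕ → Matrix (Fin n) (Fin n) ℝ) (a b : ℕ) :
    Matrix (Fin n) (Fin n) ℝ :=
  ((List.range (a + 1 - b)).map (fun i => M (a - i))).prod

/-- Gradient descent trajectory for depth-`N` matrix factorization with target `M`:
`W_j(0) = αI` and
`W_j(k+1) = W_j(k) − η (W_N(k)⋯W_{j+1}(k))ᵀ (W_N(k)⋯W_1(k) − M) (W_{j−1}(k)⋯W_1(k))ᵀ`. -/
def IsGDTrajectory {n : ℕ} (N : ℕ) (M : Matrix (Fin n) (Fin n) ℝ) (eta alpha : ℝ)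
    (W : ℕ → ℕ → Matrix (Fin n) (Fin n) ℝ) : Prop :=
  (∀ j, 1 ≤ j → j ≤ N → W j 0 = alpha • (1 : Matrix (Fin n) (Fin n) ℝ)) ∧
  (∀ j, 1 ≤ j → j ≤ N → ∀ k,
    W j (k + 1) = W j k - eta •
      ((prodDesc (fun i => W i k) N (j + 1))ᵀ *
        (prodDesc (fun i => W i k) N 1 - M) *
        (prodDesc (fun i => W i k) (j - 1) 1)ᵀ))

/-- If all factors agree, the descending product is a power. -/
theorem prodDesc_eq_pow {n : ℕ} {M : ℕ → Matrix (Fin n) (Fin n) ℝ} {A : Matrix (Fin n) (Fin n) ℝ}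
    {a b : ℕ} (h : ∀ i, b ≤ i → i ≤ a → M i = A) : prodDesc M a b = A ^ (a + 1 - b) := by
  unfold prodDesc
  rw [List.map_congr_left (g := fun _ => A), List.map_const', List.prod_replicate,
    List.length_range]
  intro i hi
  rw [List.mem_range] at hi
  exact h _ (by omega) (by omega)

theorem orthogonal_conj_pow {n : ℕ} {V : Matrix (Fin n) (Fin n) ℝ} (hV : Vᵀ * V = 1)
    (D : Matrix (Fin n) (Fin n) ℝ) (m : ℕ) : (V * D * Vᵀ) ^ m = V * D ^ m * Vᵀ := by
  induction m with
  | zero => simp [mul_eq_one_comm.mp hV]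
  | succ m ih =>
    calc (V * D * Vᵀ) ^ (m + 1) = V * D ^ m * (Vᵀ * V) * D * Vᵀ := by
          rw [pow_succ, ih]; simp only [Matrix.mul_assoc]
      _ = V * D ^ (m + 1) * Vᵀ := by
          rw [hV, Matrix.mul_one, pow_succ]; simp only [Matrix.mul_assoc]

/-- One gradient descent step from identical, simultaneously diagonalized factors. -/
theorem IsGDTrajectory.step {n N : ℕ} {V : Matrix (Fin n) (Fin n) ℝ} {s d : Fin n → ℝ}
    {alpha eta : ℝ} {W : ℕ → ℕ → Matrix (Fin n) (Fin n) ℝ} (hV : Vᵀ * V = 1)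
    (htraj : IsGDTrajectory N (V * diagonal s * Vᵀ) eta alpha W) {k : ℕ}
    (hd : ∀ j, 1 ≤ j → j ≤ N → W j k = V * diagonal d * Vᵀ) {j : ℕ} (hj : 1 ≤ j) (hjN : j ≤ N) :
    W j (k + 1) =
      V * diagonal (fun i => d i - eta * (d i ^ (N - 1) * (d i ^ N - s i))) * Vᵀ := by
  rw [htraj.2 j hj hjN k, hd j hj hjN,
    prodDesc_eq_pow (b := j + 1) fun i hi hi' => hd i (by omega) hi',
    prodDesc_eq_pow (a := N) (b := 1) fun i hi hi' => hd i hi hi',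
    prodDesc_eq_pow (a := j - 1) (b := 1) fun i hi hi' => hd i hi (by omega)]
  simp only [orthogonal_conj_pow hV, diagonal_pow, transpose_mul, transpose_transpose,
    diagonal_transpose, ← Matrix.mul_assoc]
  rw [← Matrix.sub_mul, ← Matrix.mul_sub, diagonal_sub]
  have hcancel (A B : Matrix (Fin n) (Fin n) ℝ) : A * Vᵀ * V * B = A * B := by
    rw [Matrix.mul_assoc A, hV, Matrix.mul_one]
  simp only [← Matrix.mul_assoc, hcancel]
  rw [← Matrix.smul_mul, Matrix.mul_assoc V (diagonal (d ^ _)), diagonal_mul_diagonal,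
    Matrix.mul_assoc V (diagonal _) (diagonal _), diagonal_mul_diagonal, ← Matrix.mul_smul, ← diagonal_smul, ← Matrix.sub_mul,
    ← Matrix.mul_sub, diagonal_sub]
  congr 3
  funext i
  have hexp : N - 1 = (N + 1 - (j + 1)) + (j - 1 + 1 - 1) := by omega
  simp only [Pi.smul_apply, Pi.pow_apply, smul_eq_mul, hexp, pow_add, Nat.add_sub_cancel]
  ring

theorem IsGDTrajectory.exists_diagonal {n N : ℕ} {V : Matrix (Fin n) (Fin n) ℝ} {s : Fin n → ℝ}
    {alpha eta : ℝ} {W : ℕ → ℕ → Matrix (Fin n) (Fin n) ℝ} (hV : Vᵀ * V = 1)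
    (htraj : IsGDTrajectory N (V * diagonal s * Vᵀ) eta alpha W) (k : ℕ) :
    ∃ d : Fin n → ℝ, ∀ j, 1 ≤ j → j ≤ N → W j k = V * diagonal d * Vᵀ := by
  induction k with
  | zero =>
    refine ⟨fun _ => alpha, fun j hj hjN => ?_⟩
    rw [htraj.1 j hj hjN, ← smul_one_eq_diagonal, Matrix.mul_smul, Matrix.smul_mul,
      Matrix.mul_one, mul_eq_one_comm.mp hV]
  | succ k ih =>
    obtain ⟨d, hd⟩ := ih
    exact ⟨_, fun j hj hjN => htraj.step hV hd hj hjN⟩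

/-- under identical initialization, the matrices `D_j(k) = Ṽᵀ W_j(k) Ṽ` are
diagonal and identical across `j`, with `D(0) = αI` and
`D(k+1) = D(k) − η D(k)^{N−1} (D(k)^N − Σ̃)`. -/
theorem stmt7 (n N : ℕ) (hN : 2 ≤ N)
    (Wtil Vtil Sig : Matrix (Fin n) (Fin n) ℝ)
    (hWsym : Wtilᵀ = Wtil) (hV : Vtilᵀ * Vtil = 1) (hSig : Sig.IsDiag)
    (hdecomp : Wtil = Vtil * Sig * Vtilᵀ)
    (alpha eta : ℝ) (halpha : 0 < alpha) (heta : 0 < eta)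
    (W : ℕ → ℕ → Matrix (Fin n) (Fin n) ℝ)
    (htraj : IsGDTrajectory N Wtil eta alpha W) :
    ∀ k : ℕ,
      (∀ j j', 1 ≤ j → j ≤ N → 1 ≤ j' → j' ≤ N →
        Vtilᵀ * W j k * Vtil = Vtilᵀ * W j' k * Vtil) ∧
      (∀ j, 1 ≤ j → j ≤ N → (Vtilᵀ * W j k * Vtil).IsDiag) ∧
      Vtilᵀ * W 1 0 * Vtil = alpha • (1 : Matrix (Fin n) (Fin n) ℝ) ∧
      Vtilᵀ * W 1 (k + 1) * Vtil =
        Vtilᵀ * W 1 k * Vtil - eta •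
          ((Vtilᵀ * W 1 k * Vtil) ^ (N - 1) * ((Vtilᵀ * W 1 k * Vtil) ^ N - Sig)) := by
  obtain ⟨s, rfl⟩ : ∃ s, Sig = diagonal s := ⟨Sig.diag, hSig.diagonal_diag.symm⟩
  subst hdecomp
  have hconj (A : Matrix (Fin n) (Fin n) ℝ) : Vtilᵀ * (Vtil * A * Vtilᵀ) * Vtil = A := by
    rw [Matrix.mul_assoc Vtil, ← Matrix.mul_assoc Vtilᵀ, hV, Matrix.one_mul, Matrix.mul_assoc, hV,
      Matrix.mul_one]
  intro k
  obtain ⟨d, hd⟩ := htraj.exists_diagonal hV k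
  have hN1 : 1 ≤ N := by omega
  refine ⟨fun j j' hj hjN hj' hjN' => by rw [hd j hj hjN, hd j' hj' hjN'], fun j hj hjN => ?_,
    ?_, ?_⟩
  · rw [hd j hj hjN, hconj]
    exact isDiag_diagonal d
  · rw [htraj.1 1 le_rfl hN1, Matrix.mul_smul, Matrix.smul_mul, Matrix.mul_one, hV]
  · rw [htraj.step hV hd le_rfl hN1, hd 1 le_rfl hN1, hconj, hconj, diagonal_pow, diagonal_pow,
      diagonal_sub, diagonal_mul_diagonal, ← diagonal_smul, diagonal_sub]
    rfl
end

section
/- Let α > 0, η > 0, ε' ∈ (0,1/3), ρ > 0, and let λ, μ > 0 satisfy |μ − λ| ≤ ρ and λ − ρ > α². Define T_1(x) = (1/(2ηx))·(H(x) − C_{ε'}), where H(x) = ln(x/α² − 1) and C_{ε'} = ln(1/ε' − 1). Then |T_1(μ) − T_1(λ)| < (ρ/(2η(λ − ρ)))·( 1/(λ − ρ − α²) + |H(λ) − C_{ε'}|/λ ). -/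
/-- `T_1(x) = (1/(2ηx))·(ln(x/α² − 1) − ln(1/ε' − 1))`. -/
noncomputable def Tone (lam eps' alpha eta : ℝ) : ℝ :=
  1 / (2 * eta * lam) * (Real.log (lam / alpha ^ 2 - 1) - Real.log (1 / eps' - 1))

/-- A strict Lipschitz-type bound for the logarithm on a ball of radius `r` around `y > r`. -/
theorem abs_log_sub_log_lt {x y r : ℝ} (hr : 0 < r) (hry : r < y) (hxy : |x - y| ≤ r) :
    |Real.log x - Real.log y| < r / (y - r) := by
  obtain ⟨h₁, h₂⟩ := abs_le.mp hxy
  have hx : 0 < x := by linarith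
  have hy : 0 < y := by linarith
  have hyr : 0 < y - r := by linarith
  rw [abs_lt]
  constructor
  · rcases eq_or_ne x y with rfl | hne
    · have : 0 < r / (x - r) := by positivity
      linarith
    · have hlog := Real.log_lt_sub_one_of_pos (div_pos hy hx)
        (fun h => hne ((div_eq_one_iff_eq hx.ne').mp h).symm)
      rw [Real.log_div hy.ne' hx.ne'] at hlog
      have : y / x - 1 ≤ r / (y - r) := by
        rw [div_sub_one hx.ne']
        gcongr <;> linarith
      linarith
  · have hlog := Real.log_le_sub_one_of_pos (div_pos hx hy)
    rw [Real.log_div hx.ne' hy.ne'] at hlog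
    have h₃ : x / y - 1 ≤ r / y := by
      rw [div_sub_one hy.ne']
      gcongr
    have h₄ : r / y < r / (y - r) := by
      gcongr
      linarith
    linarith

/-- perturbation bound on the end time `T_1` of the low-rank interval. -/
theorem stmt16 (alpha eta eps' ρ lam mu : ℝ)
    (halpha : 0 < alpha) (heta : 0 < eta) (heps' : eps' ∈ Set.Ioo (0 : ℝ) (1 / 3))
    (hρ : 0 < ρ) (hlam : 0 < lam) (hmu : 0 < mu)
    (hclose : |mu - lam| ≤ ρ) (hgap : alpha ^ 2 < lam - ρ) :
    |Tone mu eps' alpha eta - Tone lam eps' alpha eta| <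
      ρ / (2 * eta * (lam - ρ)) *
        (1 / (lam - ρ - alpha ^ 2)
          + |Real.log (lam / alpha ^ 2 - 1) - Real.log (1 / eps' - 1)| / lam) := by
  obtain ⟨h₁, h₂⟩ := abs_le.mp hclose
  have ha : 0 < alpha ^ 2 := by positivity
  have hd : 0 < lam - ρ := by linarith
  have hlog : |Real.log (mu / alpha ^ 2 - 1) - Real.log (lam / alpha ^ 2 - 1)| <
      ρ / (lam - ρ - alpha ^ 2) := by
    rw [div_sub_one ha.ne', div_sub_one ha.ne', Real.log_div (by linarith) ha.ne',
      Real.log_div (by linarith) ha.ne', sub_sub_sub_cancel_right, sub_right_comm lam ρ]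
    exact abs_log_sub_log_lt hρ (by linarith) (by rwa [sub_sub_sub_cancel_right])
  unfold Tone
  generalize Real.log (mu / alpha ^ 2 - 1) = M at *
  generalize Real.log (lam / alpha ^ 2 - 1) = L at *
  generalize Real.log (1 / eps' - 1) = C at *
  have hsplit : 1 / (2 * eta * mu) * (M - C) - 1 / (2 * eta * lam) * (L - C) =
      1 / (2 * eta * mu) * ((M - L) - (mu - lam) * (L - C) / lam) := by
    field_simp
    ring
  rw [hsplit, abs_mul, abs_of_pos (by positivity : 0 < 1 / (2 * eta * mu))]
  have hbound : |(M - L) - (mu - lam) * (L - C) / lam| <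
      ρ / (lam - ρ - alpha ^ 2) + ρ * |L - C| / lam := by
    refine (abs_sub _ _).trans_lt (add_lt_add_of_lt_of_le hlog ?_)
    rw [abs_div, abs_mul, abs_of_pos hlam]
    gcongr
  calc 1 / (2 * eta * mu) * |(M - L) - (mu - lam) * (L - C) / lam|
      < 1 / (2 * eta * mu) * (ρ / (lam - ρ - alpha ^ 2) + ρ * |L - C| / lam) := by gcongr
    _ ≤ 1 / (2 * eta * (lam - ρ)) * (ρ / (lam - ρ - alpha ^ 2) + ρ * |L - C| / lam) := by
      have := (abs_nonneg _).trans hbound.le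
      gcongr
      linarith
    _ = ρ / (2 * eta * (lam - ρ)) * (1 / (lam - ρ - alpha ^ 2) + |L - C| / lam) := by ring
end

section
/- Let α > 0, η > 0, ε ∈ (0,1), ρ > 0, and let λ, μ > 0 satisfy |μ − λ| ≤ ρ, λ − ρ > α², and 0 < (2/3)·η·(λ + ρ) < 1. Define T(x) = A(x) + B(x) + C(x) with A(x) = (1/(2ηx))·(ln(x/α² − 1) − ln 2), B(x) = ⌈(1/α)·√(x/3)⌉, C(x) = K_ε/|ln(1 − (2/3)ηx)|, and set H(x) = ln(x/α² − 1), C_2 = ln 2. Then |T(μ) − T(λ)| < (ρ/(2η(λ − ρ)))·( 1/(λ − ρ − α²) + |H(λ) − C_2|/λ ) + ρ/(√3·α·(√(λ − ρ) + √λ)) + 9K_ε·ρ/(2ηλ·(λ − ρ)·|3 − 2η(λ + ρ)|) + 1. -/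
theorem abs_log_sub_log_le {m x y : ℝ} (hm : 0 < m) (hx : m ≤ x) (hy : m ≤ y) :
    |Real.log x - Real.log y| ≤ |x - y| / m := by
  wlog hxy : y ≤ x generalizing x y
  · rw [abs_sub_comm, abs_sub_comm x]
    exact this hy hx (le_of_not_ge hxy)
  have hy0 : 0 < y := hm.trans_le hy
  have hx0 : 0 < x := hm.trans_le hx
  rw [abs_of_nonneg (sub_nonneg.2 (Real.log_le_log hy0 hxy)), abs_of_nonneg (sub_nonneg.2 hxy),
    ← Real.log_div hx0.ne' hy0.ne']
  calc Real.log (x / y) ≤ x / y - 1 := Real.log_le_sub_one_of_pos (div_pos hx0 hy0)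
    _ = (x - y) / y := by field_simp
    _ ≤ (x - y) / m := div_le_div_of_nonneg_left (sub_nonneg.2 hxy) hm hy

theorem abs_ceil_sub_ceil_lt (x y : ℝ) : |((⌈x⌉ : ℤ) : ℝ) - (⌈y⌉ : ℤ)| < |x - y| + 1 := by
  rw [abs_lt]
  constructor <;>
    linarith [Int.le_ceil x, Int.le_ceil y, Int.ceil_lt_add_one x, Int.ceil_lt_add_one y,
      le_abs_self (x - y), neg_abs_le (x - y)]

theorem Keps_nonneg {eps : ℝ} (heps : eps ∈ Set.Ioo (0 : ℝ) 1) : 0 ≤ Keps eps := by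
  obtain ⟨h0, h1⟩ := heps
  have hs : Real.sqrt (1 / 3) ≤ 3 / 5 := Real.sqrt_le_iff.2 (by norm_num)
  have hs0 := Real.sqrt_nonneg (1 / 3)
  have h8 : 8 ≤ 8 / eps := by
    rw [le_div_iff₀ h0]
    linarith
  rw [Keps, abs_of_nonpos (Real.log_nonpos (by linarith) (by linarith)), sub_neg_eq_add,
    ← Real.log_mul (by positivity) (by linarith)]
  exact Real.log_nonneg (by nlinarith)

theorem abs_Afun_sub_le {alpha eta ρ lam mu : ℝ} (halpha : 0 < alpha) (heta : 0 < eta)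
    (hclose : |mu - lam| ≤ ρ) (hgap : alpha ^ 2 < lam - ρ) :
    |Afun alpha eta mu - Afun alpha eta lam| ≤
      ρ / (2 * eta * (lam - ρ)) *
        (1 / (lam - ρ - alpha ^ 2)
          + |Real.log (lam / alpha ^ 2 - 1) - Real.log 2| / lam) := by
  have hρ : 0 ≤ ρ := (abs_nonneg _).trans hclose
  have ha2 : 0 < alpha ^ 2 := by positivity
  have ha : 0 < lam - ρ := ha2.trans hgap
  have hd : 0 < lam - ρ - alpha ^ 2 := sub_pos.2 hgap
  have hmu : lam - ρ ≤ mu := by linarith [(abs_le.1 hclose).1]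
  have hmu0 : 0 < mu := ha.trans_le hmu
  have hlam0 : 0 < lam := by linarith
  have hlog : |Real.log (mu / alpha ^ 2 - 1) - Real.log (lam / alpha ^ 2 - 1)| ≤
      ρ / (lam - ρ - alpha ^ 2) := by
    have key : ∀ x, x / alpha ^ 2 - 1 = (x - alpha ^ 2) / alpha ^ 2 := fun x => by field_simp
    rw [key, key, Real.log_div (by linarith) ha2.ne', Real.log_div (by linarith) ha2.ne',
      sub_sub_sub_cancel_right]
    refine (abs_log_sub_log_le hd (by linarith) (by linarith)).trans ?_
    rw [sub_sub_sub_cancel_right]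
    gcongr
  have hsplit : Afun alpha eta mu - Afun alpha eta lam =
      1 / (2 * eta * mu) * (Real.log (mu / alpha ^ 2 - 1) - Real.log (lam / alpha ^ 2 - 1)) +
      (lam - mu) / (2 * eta * mu) *
        ((Real.log (lam / alpha ^ 2 - 1) - Real.log 2) / lam) := by
    unfold Afun
    field_simp
    ring
  rw [hsplit]
  refine (abs_add_le _ _).trans ?_
  have hden : 0 < 2 * eta * mu := by positivity
  rw [abs_mul, abs_mul, abs_div, abs_div, abs_div, abs_one, abs_of_pos hden, abs_of_pos hlam0,
    abs_sub_comm lam mu, mul_add]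
  gcongr ?_ + ?_
  · calc _ ≤ 1 / (2 * eta * (lam - ρ)) * (ρ / (lam - ρ - alpha ^ 2)) := by gcongr
      _ = _ := by ring
  · gcongr

theorem abs_Bfun_sub_lt {alpha ρ lam mu : ℝ} (halpha : 0 < alpha)
    (hclose : |mu - lam| ≤ ρ) (ha : 0 < lam - ρ) :
    |Bfun alpha mu - Bfun alpha lam| <
      ρ / (Real.sqrt 3 * alpha * (Real.sqrt (lam - ρ) + Real.sqrt lam)) + 1 := by
  have hρ : 0 ≤ ρ := (abs_nonneg _).trans hclose
  have hmu : lam - ρ ≤ mu := by linarith [(abs_le.1 hclose).1]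
  have hmu0 : 0 < mu := ha.trans_le hmu
  have hlam0 : 0 < lam := by linarith
  refine (abs_ceil_sub_ceil_lt _ _).trans_le ?_
  gcongr
  have hsum : 0 < Real.sqrt mu + Real.sqrt lam := by positivity
  have heq : Real.sqrt (mu / 3) / alpha - Real.sqrt (lam / 3) / alpha =
      (mu - lam) / (Real.sqrt 3 * alpha * (Real.sqrt mu + Real.sqrt lam)) := by
    rw [Real.sqrt_div hmu0.le, Real.sqrt_div hlam0.le]
    field_simp
    linear_combination Real.sq_sqrt hmu0.le - Real.sq_sqrt hlam0.le
  rw [heq, abs_div, abs_of_pos (by positivity : 0 < Real.sqrt 3 * alpha * (√mu + √lam))]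
  gcongr

theorem le_abs_log_one_sub {t : ℝ} (h1 : t < 1) : t ≤ |Real.log (1 - t)| := by
  linarith [neg_le_abs (Real.log (1 - t)), Real.log_le_sub_one_of_pos (sub_pos.2 h1)]

theorem abs_Cfun_sub_le {eta K ρ lam mu : ℝ} (heta : 0 < eta) (hK : 0 ≤ K)
    (hclose : |mu - lam| ≤ ρ) (ha : 0 < lam - ρ) (hstep : 2 / 3 * eta * (lam + ρ) < 1) :
    |Cfun eta K mu - Cfun eta K lam| ≤
      9 * K * ρ / (2 * eta * lam * (lam - ρ) * |3 - 2 * eta * (lam + ρ)|) := by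
  have hρ : 0 ≤ ρ := (abs_nonneg _).trans hclose
  obtain ⟨hlo, hhi⟩ := abs_le.1 hclose
  have hmu : lam - ρ ≤ mu := by linarith
  have hmu0 : 0 < mu := ha.trans_le hmu
  have hlam0 : 0 < lam := by linarith
  set c := 2 / 3 * eta with hc
  have hc0 : 0 < c := by positivity
  have hm : 0 < 1 - c * (lam + ρ) := sub_pos.2 hstep
  have hcm : c * mu ≤ c * (lam + ρ) := by gcongr; linarith
  have hcl : c * lam ≤ c * (lam + ρ) := by gcongr; linarith
  have hLm : c * (lam - ρ) ≤ |Real.log (1 - c * mu)| :=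
    (mul_le_mul_of_nonneg_left hmu hc0.le).trans
      (le_abs_log_one_sub (by linarith))
  have hLl : c * lam ≤ |Real.log (1 - c * lam)| :=
    le_abs_log_one_sub (by linarith)
  have hLm0 : 0 < |Real.log (1 - c * mu)| := (mul_pos hc0 ha).trans_le hLm
  have hLl0 : 0 < |Real.log (1 - c * lam)| := (mul_pos hc0 hlam0).trans_le hLl
  have hlog : |(|Real.log (1 - c * lam)| - |Real.log (1 - c * mu)|)| ≤
      c * ρ / (1 - c * (lam + ρ)) := by
    refine (abs_abs_sub_abs_le _ _).trans
      ((abs_log_sub_log_le hm (by linarith) (by linarith)).trans ?_)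
    rw [show 1 - c * lam - (1 - c * mu) = c * (mu - lam) by ring, abs_mul, abs_of_pos hc0]
    gcongr
  have heq : Cfun eta K mu - Cfun eta K lam =
      K * ((|Real.log (1 - c * lam)| - |Real.log (1 - c * mu)|) /
        (|Real.log (1 - c * mu)| * |Real.log (1 - c * lam)|)) := by
    rw [Cfun, Cfun, ← hc]
    field_simp
  rw [heq, abs_mul, abs_of_nonneg hK, abs_div, abs_of_pos (mul_pos hLm0 hLl0)]
  have h3 : 3 - 2 * eta * (lam + ρ) = 3 * (1 - c * (lam + ρ)) := by rw [hc]; ring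
  have heta' : eta = 3 / 2 * c := by rw [hc]; ring
  calc _ ≤ K * ((c * ρ / (1 - c * (lam + ρ))) / (c * (lam - ρ) * (c * lam))) := by gcongr
    _ = _ := by
      rw [h3, abs_of_pos (by positivity), heta']
      field_simp
      ring

/-- perturbation bound on the start time `T` of the low-rank interval. -/
theorem stmt17 (alpha eta eps ρ lam mu : ℝ)
    (halpha : 0 < alpha) (heta : 0 < eta) (heps : eps ∈ Set.Ioo (0 : ℝ) 1)
    (hρ : 0 < ρ) (hlam : 0 < lam) (hmu : 0 < mu)
    (hclose : |mu - lam| ≤ ρ) (hgap : alpha ^ 2 < lam - ρ)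
    (hstep : 0 < 2 / 3 * eta * (lam + ρ) ∧ 2 / 3 * eta * (lam + ρ) < 1) :
    |Tfun alpha eta eps mu - Tfun alpha eta eps lam| <
      ρ / (2 * eta * (lam - ρ)) *
        (1 / (lam - ρ - alpha ^ 2)
          + |Real.log (lam / alpha ^ 2 - 1) - Real.log 2| / lam)
      + ρ / (Real.sqrt 3 * alpha * (Real.sqrt (lam - ρ) + Real.sqrt lam))
      + 9 * Keps eps * ρ / (2 * eta * lam * (lam - ρ) * |3 - 2 * eta * (lam + ρ)|)
      + 1 := by
  have ha : 0 < lam - ρ := (pow_pos halpha 2).trans hgap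
  have hA := abs_Afun_sub_le halpha heta hclose hgap
  have hB := abs_Bfun_sub_lt halpha hclose ha
  have hC := abs_Cfun_sub_le heta (Keps_nonneg heps) hclose ha hstep.2
  have hsplit : Tfun alpha eta eps mu - Tfun alpha eta eps lam =
      (Afun alpha eta mu - Afun alpha eta lam) + (Bfun alpha mu - Bfun alpha lam) +
        (Cfun eta (Keps eps) mu - Cfun eta (Keps eps) lam) := by
    unfold Tfun
    ring
  rw [hsplit]
  refine (abs_add_three _ _ _).trans_lt ?_
  linarith
end
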